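/- arXiv:1502.00129 — 3 statements merged into one kernel-verified Lean document; each statement's English description precedes it below -/
import Mathlib

section
/- Let Γ be a finite simplicial graph that is connected and not a complete graph. If the right-angled Artin group A(Γ) acts without inversions on a simplicial tree with no global fixed vertex and with all edge stabilizers abelian, then Γ contains a separating clique. -/
/-- The relators of the right-angled Artin group of a graph `Γ`: one commutator
relator for each pair of adjacent vertices. -/
def raagRels {V : Type} (Γ : SimpleGraph V) : Set (FreeGroup V) :=
  {r | ∃ u v : V, Γ.Adj u v ∧
    r = FreeGroup.of u * FreeGroup.of v * (FreeGroup.of u)⁻¹ * (FreeGroup.of v)⁻¹}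

/-- The right-angled Artin group `A(Γ)` of a graph `Γ`. -/
abbrev RAAG {V : Type} (Γ : SimpleGraph V) : Type := PresentedGroup (raagRels Γ)

/-- The generator of `RAAG Γ` corresponding to a vertex `v`. -/
def RAAG.gen {V : Type} (Γ : SimpleGraph V) (v : V) : RAAG Γ := PresentedGroup.of v

section Action

variable {G W : Type} [Group G]

/-- The homomorphism `φ : G →* Equiv.Perm W` acts by automorphisms of the graph `T`. -/
def PreservesAdj (T : SimpleGraph W) (φ : G →* Equiv.Perm W) : Prop :=
  ∀ (g : G) (u v : W), T.Adj u v → T.Adj (φ g u) (φ g v)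

/-- The action `φ` on the graph `T` is without edge inversions. -/
def NoInversions (T : SimpleGraph W) (φ : G →* Equiv.Perm W) : Prop :=
  ∀ (g : G) (u v : W), T.Adj u v → ¬(φ g u = v ∧ φ g v = u)

/-- All edge stabilizers of the action `φ` on the graph `T` are abelian: any two
elements fixing both endpoints of an edge commute. -/
def AbelianEdgeStabilizers (T : SimpleGraph W) (φ : G →* Equiv.Perm W) : Prop :=
  ∀ u v : W, T.Adj u v → ∀ g h : G,
    φ g u = u → φ g v = v → φ h u = u → φ h v = v → g * h = h * g

/-- An element `g` is elliptic for the action `φ` if it fixes some vertex. -/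
def Elliptic (φ : G →* Equiv.Perm W) (g : G) : Prop := ∃ w : W, φ g w = w

/-- The action `φ` has a global fixed vertex. -/
def HasGlobalFixedVertex (φ : G →* Equiv.Perm W) : Prop := ∃ w : W, ∀ g : G, φ g w = w

end Action

/-- `K` is a separating clique of `Γ`: a clique whose removal disconnects `Γ`. -/
def SeparatingClique {V : Type} (Γ : SimpleGraph V) (K : Set V) : Prop :=
  Γ.IsClique K ∧ ∃ x y : ↥(Kᶜ), ¬ (Γ.induce Kᶜ).Reachable x y

/-- `p` and `q` lie on the same side of the edge `e` of `T`. -/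
def SameSide {W : Type} (T : SimpleGraph W) (e : Sym2 W) (p q : W) : Prop :=
  (T.deleteEdges {e}).Reachable p q

namespace SameSide

variable {W : Type} {T : SimpleGraph W} {e : Sym2 W} {p q r x y : W}

lemma refl (p : W) : SameSide T e p p := SimpleGraph.Reachable.refl p

lemma symm (h : SameSide T e p q) : SameSide T e q p := SimpleGraph.Reachable.symm h

lemma trans (h : SameSide T e p q) (h' : SameSide T e q r) : SameSide T e p r :=
  SimpleGraph.Reachable.trans h h'

lemma of_adj (h : T.Adj x y) (hne : s(x, y) ≠ e) : SameSide T e x y :=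
  SimpleGraph.Adj.reachable (SimpleGraph.deleteEdges_adj.2 ⟨h, by simpa using hne⟩)

lemma mem_edges_of_not (w : T.Walk p q) (h : ¬ SameSide T e p q) : e ∈ w.edges := by
  induction w with
  | nil => exact absurd (refl _) h
  | @cons a b c hab w ih =>
    rw [SimpleGraph.Walk.edges_cons, List.mem_cons]
    by_cases he : e = s(a, b)
    · exact Or.inl he
    · exact Or.inr (ih fun hbc => h ((of_adj hab (Ne.symm he)).trans hbc))

lemma not_of_adj (hT : T.IsAcyclic) (h : T.Adj x y) : ¬ SameSide T s(x, y) x y :=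
  SimpleGraph.isBridge_iff.1 (SimpleGraph.isAcyclic_iff_forall_adj_isBridge.1 hT h)

lemma not_of_mem_edges (hT : T.IsAcyclic) {w : T.Walk p q} (hw : w.IsPath) (he : e ∈ w.edges) :
    ¬ SameSide T e p q := by
  intro h
  obtain ⟨w', hw'⟩ := SimpleGraph.Reachable.exists_isPath h
  have hle : T.deleteEdges {e} ≤ T := SimpleGraph.deleteEdges_le _
  have hpath : (w'.mapLe hle).IsPath := (SimpleGraph.Walk.isPath_mapLe hle).2 hw'
  have heq : w = w'.mapLe hle :=
    congrArg Subtype.val ((hT.subsingleton_path p q).elim ⟨w, hw⟩ ⟨_, hpath⟩)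
  rw [heq, SimpleGraph.Walk.edges_mapLe_eq_edges] at he
  have := SimpleGraph.Walk.edges_subset_edgeSet w' he
  simp at this

/-- At most one of the edges at a vertex `x` separates `x` from a given vertex. -/
lemma eq_of_not (hT : T.IsTree) (h : ¬ SameSide T s(x, p) x r) (h' : ¬ SameSide T s(x, q) x r) :
    p = q := by
  obtain ⟨w, hw⟩ := hT.connected.exists_isPath x r
  have h1 := mem_edges_of_not w h
  have h2 := mem_edges_of_not w h'
  cases w with
  | nil => simp at h1
  | @cons _ b _ hab w =>
    have hx := (SimpleGraph.Walk.cons_isPath_iff _ _).1 hw |>.2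
    have key : ∀ z, s(x, z) ∈ (SimpleGraph.Walk.cons hab w).edges → z = b := by
      intro z hz
      rw [SimpleGraph.Walk.edges_cons, List.mem_cons] at hz
      rcases hz with hz | hz
      · exact Sym2.congr_right.1 hz
      · exact absurd (w.fst_mem_support_of_mem_edges hz) hx
    rw [key p h1, key q h2]

/-- A walk leaving a set `C` crosses a boundary edge of `C`. -/
lemma exists_boundary (hT : T.IsTree) (C : Set W) (hp : p ∈ C) (hq : q ∉ C) :
    ∃ x y, T.Adj x y ∧ x ∈ C ∧ y ∉ C ∧ ¬ SameSide T s(x, y) p q := by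
  obtain ⟨w, hw⟩ := hT.connected.exists_isPath p q
  obtain ⟨d, hd, h1, h2⟩ := w.exists_boundary_dart C hp hq
  exact ⟨d.fst, d.snd, d.adj, h1, h2,
    not_of_mem_edges hT.isAcyclic hw (List.mem_map_of_mem (f := SimpleGraph.Dart.edge) hd)⟩

variable {G : Type} [Group G] {φ : G →* Equiv.Perm W}

lemma map (hadj : PreservesAdj T φ) (g : G) (h : SameSide T s(x, y) p q) :
    SameSide T s(φ g x, φ g y) (φ g p) (φ g q) := by
  refine SimpleGraph.Reachable.map (G' := T.deleteEdges {s(φ g x, φ g y)}) ⟨φ g, ?_⟩ h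
  intro a b hab
  rw [SimpleGraph.deleteEdges_adj] at hab ⊢
  refine ⟨hadj g a b hab.1, fun he => hab.2 ?_⟩
  simpa using he

lemma map_iff (hadj : PreservesAdj T φ) (g : G) :
    SameSide T s(φ g x, φ g y) (φ g p) (φ g q) ↔ SameSide T s(x, y) p q :=
  ⟨fun h => by simpa using h.map hadj g⁻¹, map hadj g⟩

/-- The fixed point set of `g` is convex. -/
lemma fixed_of_not (hT : T.IsTree) (hadj : PreservesAdj T φ) {g : G} (hp : φ g p = p)
    (hq : φ g q = q) (h : ¬ SameSide T s(x, y) p q) : φ g x = x ∧ φ g y = y := by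
  obtain ⟨w, hw⟩ := hT.connected.exists_isPath p q
  let f : T →g T := ⟨φ g, fun {a b} => hadj g a b⟩
  have hpath : ((w.map f).copy hp hq).IsPath := by
    simpa using hw.map (f := f) (φ g).injective
  have heq : (w.map f).copy hp hq = w :=
    congrArg Subtype.val ((hT.isAcyclic.subsingleton_path p q).elim ⟨_, hpath⟩ ⟨w, hw⟩)
  have hsupp : w.support.map (φ g) = w.support := by
    have := congrArg SimpleGraph.Walk.support heq
    rwa [SimpleGraph.Walk.support_copy, SimpleGraph.Walk.support_map] at this
  have hfix : ∀ a ∈ w.support, φ g a = a :=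
    List.map_inj_left.1 (hsupp.trans (List.map_id _).symm)
  have he := mem_edges_of_not w h
  exact ⟨hfix _ (w.fst_mem_support_of_mem_edges he), hfix _ (w.snd_mem_support_of_mem_edges he)⟩

end SameSide

section Elliptic

variable {G W : Type} [Group G] {T : SimpleGraph W} {φ : G →* Equiv.Perm W}

/-- Commuting elliptic elements have a common fixed vertex. -/
lemma exists_common_fixed_of_commute (hT : T.IsTree) (hadj : PreservesAdj T φ) {u w : G}
    (huw : Commute u w) (hu : Elliptic φ u) (hw : Elliptic φ w) :
    ∃ p, φ u p = p ∧ φ w p = p := by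
  obtain ⟨p, hp⟩ := hu
  obtain ⟨q, hq⟩ := hw
  by_contra! hno
  obtain ⟨x, y, hxy, hx, hy, hsep⟩ := SameSide.exists_boundary hT {z | φ u z = z} (p := p) (q := q)
    hp fun h => hno q h hq
  have hxq : ¬ SameSide T s(x, y) x q := by
    intro h
    refine hsep (SameSide.trans ?_ h)
    by_contra hpx
    exact hy (SameSide.fixed_of_not hT hadj hp hx hpx).2
  have huq : φ w (φ u q) = φ u q := by
    rw [← Equiv.Perm.mul_apply, ← map_mul, ← huw.eq, map_mul, Equiv.Perm.mul_apply, hq]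
  have hquq : SameSide T s(x, y) q (φ u q) := by
    by_contra h
    exact hno x hx (SameSide.fixed_of_not hT hadj hq huq h).1
  have h1 : ¬ SameSide T s(x, y) x (φ u q) := fun h => hxq (h.trans hquq.symm)
  have h2 : ¬ SameSide T s(x, φ u y) x (φ u q) := by
    have := mt (SameSide.map_iff hadj u).1 hxq
    rwa [show φ u x = x from hx] at this
  exact hy (SameSide.eq_of_not hT h1 h2).symm

end Elliptic

/-- A bi-infinite walk without backtracking. -/
structure IsLine {W : Type} (T : SimpleGraph W) (f : ℤ → W) : Prop where
  adj : ∀ n, T.Adj (f n) (f (n + 1))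
  ne : ∀ n, f n ≠ f (n + 1 + 1)

namespace IsLine

variable {W : Type} {T : SimpleGraph W} {f g : ℤ → W}

lemma neg (hf : IsLine T f) : IsLine T fun n => f (-n) where
  adj n := by
    have := (hf.adj (-(n + 1))).symm
    rwa [show -(n + 1) + 1 = -n by ring] at this
  ne n := by
    have := (hf.ne (-(n + 1 + 1))).symm
    rwa [show -(n + 1 + 1) + 1 + 1 = -n by ring] at this

lemma sameSide_add (hT : T.IsTree) (hf : IsLine T f) (n : ℤ) (m : ℕ) :
    SameSide T s(f n, f (n + 1)) (f (n + 1)) (f (n + 1 + m)) := by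
  induction m generalizing n with
  | zero => simpa using SameSide.refl _
  | succ m ih =>
    by_contra h
    have h1 := ih (n + 1)
    have h2 : ¬ SameSide T s(f (n + 1), f (n + 1 + 1)) (f (n + 1)) (f (n + 1 + 1 + m)) :=
      fun h' => SameSide.not_of_adj hT.isAcyclic (hf.adj (n + 1)) (h'.trans h1.symm)
    rw [show n + 1 + ((m + 1 : ℕ) : ℤ) = n + 1 + 1 + m by push_cast; ring, Sym2.eq_swap] at h
    exact hf.ne n (SameSide.eq_of_not hT h h2)

lemma sameSide_right (hT : T.IsTree) (hf : IsLine T f) {n m : ℤ} (h : n < m) :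
    SameSide T s(f n, f (n + 1)) (f (n + 1)) (f m) := by
  obtain ⟨k, hk⟩ := Int.le.dest (Int.add_one_le_of_lt h)
  simpa [hk] using hf.sameSide_add hT n k

lemma sameSide_left (hT : T.IsTree) (hf : IsLine T f) {n m : ℤ} (h : m ≤ n) :
    SameSide T s(f n, f (n + 1)) (f n) (f m) := by
  have := hf.neg.sameSide_right hT (n := -(n + 1)) (m := -m) (by omega)
  simp only [neg_neg] at this
  rwa [show -(-(n + 1) + 1) = n by ring, Sym2.eq_swap] at this

lemma not_sameSide (hT : T.IsTree) (hf : IsLine T f) {k n m : ℤ} (hk : k ≤ n) (hm : n < m) :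
    ¬ SameSide T s(f n, f (n + 1)) (f k) (f m) := fun h =>
  SameSide.not_of_adj hT.isAcyclic (hf.adj n)
    (((hf.sameSide_left hT hk).trans h).trans (hf.sameSide_right hT hm).symm)

lemma injective (hT : T.IsTree) (hf : IsLine T f) : Function.Injective f := by
  have key : ∀ k m, k < m → f k ≠ f m := fun k m h he =>
    hf.not_sameSide hT le_rfl h (he ▸ SameSide.refl _)
  intro k m h
  rcases lt_trichotomy k m with hlt | heq | hlt
  · exact absurd h (key _ _ hlt)
  · exact heq
  · exact absurd h.symm (key _ _ hlt)

lemma edge_injective (hT : T.IsTree) (hf : IsLine T f) :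
    Function.Injective fun n => s(f n, f (n + 1)) := by
  intro n m h
  rcases Sym2.eq_iff.1 h with ⟨h1, -⟩ | ⟨h1, h2⟩
  · exact hf.injective hT h1
  · have := hf.injective hT h1
    have := hf.injective hT h2
    omega

lemma exists_edge_eq (hf : IsLine T f) {e : Sym2 W} {a b : ℤ} (hab : a ≤ b)
    (h : ¬ SameSide T e (f a) (f b)) : ∃ j, a ≤ j ∧ j < b ∧ e = s(f j, f (j + 1)) := by
  by_contra! hno
  refine h ?_
  have key : ∀ n : ℕ, a + n ≤ b → SameSide T e (f a) (f (a + n)) := by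
    intro n
    induction n with
    | zero => intro _; simpa using SameSide.refl _
    | succ n ih =>
      intro hn
      push_cast at hn ⊢
      rw [← add_assoc]
      exact (ih (by omega)).trans
        (SameSide.of_adj (hf.adj _) (hno _ (by omega) (by omega)).symm)
  obtain ⟨n, hn⟩ := Int.le.dest hab
  rw [← hn]
  exact key n hn.le

variable {G : Type} [Group G] {φ : G →* Equiv.Perm W}

lemma comp (hadj : PreservesAdj T φ) (hf : IsLine T f) (g : G) : IsLine T fun n => φ g (f n) where
  adj n := hadj g _ _ (hf.adj n)
  ne n := fun h => hf.ne n ((φ g).injective h)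

end IsLine

section Axis

variable {G W : Type} [Group G] {T : SimpleGraph W} {φ : G →* Equiv.Perm W} {f g : ℤ → W}
  {v : G} {l : ℤ}

lemma zpow_apply_of_shift (hv : ∀ n, φ v (f n) = f (n + l)) (n k : ℤ) :
    φ (v ^ n) (f k) = f (k + n * l) := by
  induction n using Int.induction_on with
  | zero => simp
  | succ n ih =>
    rw [add_comm, zpow_add, map_mul, Equiv.Perm.mul_apply, ih, zpow_one, hv]
    congr 1; ring
  | pred n ih =>
    rw [sub_eq_neg_add, zpow_add, map_mul, Equiv.Perm.mul_apply, ih, zpow_neg_one, map_inv,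
      Equiv.Perm.inv_eq_iff_eq, hv]
    congr 1; ring

/-- Two lines translated by the same element coincide. -/
lemma IsLine.exists_eq_of_shift (hT : T.IsTree) (hadj : PreservesAdj T φ) (hf : IsLine T f)
    (hg : IsLine T g) (hl : 0 < l) (hfv : ∀ n, φ v (f n) = f (n + l))
    (hgv : ∀ n, φ v (g n) = g (n + l)) (k : ℤ) : ∃ j, f k = g j ∧ f (k + 1) = g (j + 1) := by
  have hfin : {n : ℤ | ¬ SameSide T s(f k, f (k + 1)) (f (n * l)) (g (n * l))}.Finite := by
    obtain ⟨w⟩ := hT.connected.preconnected (f 0) (g 0)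
    refine Set.Finite.of_injOn (f := fun n : ℤ => s(f (k - n * l), f (k - n * l + 1)))
      (t := {e | e ∈ w.edges}) ?_ ?_ w.edges.finite_toSet
    · intro n hn
      refine SameSide.mem_edges_of_not w fun h => hn ?_
      have := h.map hadj (v ^ n)
      simp only [zpow_apply_of_shift hfv, zpow_apply_of_shift hgv] at this
      convert this using 2 <;> ring_nf
    · intro n _ m _ h
      have := hf.edge_injective hT h
      simpa [hl.ne'] using this
  obtain ⟨B, hB⟩ := hfin.bddAbove
  obtain ⟨A, hA⟩ := hfin.bddBelow
  obtain ⟨N, hNB, hNA, hNk, hNk'⟩ : ∃ N : ℤ, B < N ∧ -N < A ∧ k < N ∧ -N ≤ k :=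
    ⟨|A| + |B| + |k| + 1, by grind, by grind, by grind, by grind⟩
  have hN : 0 ≤ N := by omega
  have hNl : N ≤ N * l := by nlinarith
  have hpos : SameSide T s(f k, f (k + 1)) (f (N * l)) (g (N * l)) := by
    by_contra h
    exact (hB h).not_gt hNB
  have hneg : SameSide T s(f k, f (k + 1)) (f (-N * l)) (g (-N * l)) := by
    by_contra h
    exact (hA h).not_gt hNA
  have hsep : ¬ SameSide T s(f k, f (k + 1)) (g (-N * l)) (g (N * l)) := fun h =>
    hf.not_sameSide hT (k := -N * l) (n := k) (m := N * l) (by linarith) (by linarith)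
      ((hneg.trans h).trans hpos.symm)
  obtain ⟨j, -, hj, he⟩ := hg.exists_edge_eq (by linarith) hsep
  rcases Sym2.eq_iff.1 he with ⟨h1, h2⟩ | ⟨h1, h2⟩
  · exact ⟨j, h1, h2⟩
  · refine absurd (SameSide.trans ?_ (hpos.symm.trans
      (hf.sameSide_right hT (by linarith)).symm)) (SameSide.not_of_adj hT.isAcyclic (hf.adj k))
    have := hg.sameSide_right hT hj
    rwa [← he, ← h1] at this

/-- The centralizer of a translation of a line acts on this line by translations. -/
lemma IsLine.exists_shift_of_commute (hT : T.IsTree) (hadj : PreservesAdj T φ) (hf : IsLine T f)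
    (hl : 0 < l) (hfv : ∀ n, φ v (f n) = f (n + l)) {a : G} (ha : Commute v a) :
    ∃ t, ∀ n, φ a (f n) = f (n + t) := by
  have hshift : ∀ n, φ v (φ a (f n)) = φ a (f (n + l)) := by
    intro n
    rw [← Equiv.Perm.mul_apply, ← map_mul, ha.eq, map_mul, Equiv.Perm.mul_apply, hfv]
  have key := (hf.comp hadj a).exists_eq_of_shift hT hadj hf hl hshift hfv
  obtain ⟨t, ht, -⟩ := key 0
  refine ⟨t, fun n => ?_⟩
  induction n using Int.induction_on with
  | zero => simpa using ht
  | succ n ih =>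
    obtain ⟨j, h1, h2⟩ := key n
    have := hf.injective hT (h1.symm.trans ih)
    rw [h2, this]
    congr 1; ring
  | pred n ih =>
    obtain ⟨j, h1, h2⟩ := key (-n - 1)
    rw [show -(n : ℤ) - 1 + 1 = -n by ring] at h2
    have := hf.injective hT (h2.symm.trans ih)
    rw [h1]
    congr 1; omega

lemma commutator_apply_of_shift {a b : G} (ha : ∃ t, ∀ n, φ a (f n) = f (n + t))
    (hb : ∃ t, ∀ n, φ b (f n) = f (n + t)) (n : ℤ) : φ (a * b * a⁻¹ * b⁻¹) (f n) = f n := by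
  obtain ⟨s, hs⟩ := ha
  obtain ⟨t, ht⟩ := hb
  have hs' : ∀ n, φ a⁻¹ (f n) = f (n - s) := fun n => by
    rw [map_inv, Equiv.Perm.inv_eq_iff_eq, hs, sub_add_cancel]
  have ht' : ∀ n, φ b⁻¹ (f n) = f (n - t) := fun n => by
    rw [map_inv, Equiv.Perm.inv_eq_iff_eq, ht, sub_add_cancel]
  simp only [map_mul, Equiv.Perm.mul_apply]
  rw [ht', hs', ht, hs]
  congr 1; ring

/-- An element without fixed vertices translates a line. -/
lemma exists_axis (hT : T.IsTree) (hadj : PreservesAdj T φ) (hni : NoInversions T φ)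
    (hv : ¬ Elliptic φ v) :
    ∃ (f : ℤ → W) (l : ℤ), IsLine T f ∧ 0 < l ∧ ∀ n, φ v (f n) = f (n + l) := by
  have := hT.connected.nonempty
  obtain ⟨w, hw⟩ : ∃ w, ∀ x, T.dist w (φ v w) ≤ T.dist x (φ v x) :=
    ⟨Function.argmin fun x => T.dist x (φ v x),
      fun x => Function.argmin_le (fun x => T.dist x (φ v x)) x⟩
  obtain ⟨P, hP⟩ := hT.connected.exists_walk_length_eq_dist w (φ v w)
  rw [← hP] at hw
  have hlen : 0 < P.length := by
    rw [hP]
    exact hT.connected.pos_dist_of_ne fun h => hv ⟨w, h.symm⟩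
  obtain ⟨l, hl⟩ : ∃ l : ℤ, l = P.length := ⟨_, rfl⟩
  have hl0 : 0 < l := by omega
  let f : ℤ → W := fun n => φ (v ^ (n / l)) (P.getVert (n % l).toNat)
  have hf0 : ∀ q r : ℤ, 0 ≤ r → r < l → f (r + q * l) = φ (v ^ q) (P.getVert r.toNat) := by
    intro q r h0 h1
    simp only [f]
    rw [Int.add_mul_ediv_right _ _ hl0.ne', Int.add_mul_emod_self_right,
      Int.ediv_eq_zero_of_lt h0 h1, Int.emod_eq_of_lt h0 h1, zero_add]
  have hf1 : ∀ q r : ℤ, 0 ≤ r → r ≤ l → f (r + q * l) = φ (v ^ q) (P.getVert r.toNat) := by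
    intro q r h0 h1
    rcases h1.lt_or_eq with h1 | rfl
    · exact hf0 q r h0 h1
    · have := hf0 (q + 1) 0 le_rfl hl0
      rw [show r + q * r = 0 + (q + 1) * r by ring, this, hl]
      simp [zpow_add, map_mul, Equiv.Perm.mul_apply]
  have hdecomp : ∀ n : ℤ, ∃ q r : ℤ, 0 ≤ r ∧ r < l ∧ n = r + q * l := fun n =>
    ⟨n / l, n % l, Int.emod_nonneg _ hl0.ne', Int.emod_lt_of_pos _ hl0,
      by linarith [Int.emod_add_mul_ediv n l, mul_comm l (n / l)]⟩
  have hshift : ∀ n, φ v (f n) = f (n + l) := by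
    intro n
    obtain ⟨q, r, h0, h1, rfl⟩ := hdecomp n
    rw [hf0 q r h0 h1, show r + q * l + l = r + (1 + q) * l by ring, hf0 (1 + q) r h0 h1,
      zpow_add, zpow_one, map_mul, Equiv.Perm.mul_apply]
  have hfadj : ∀ n, T.Adj (f n) (f (n + 1)) := by
    intro n
    obtain ⟨q, r, h0, h1, rfl⟩ := hdecomp n
    rw [show r + q * l + 1 = (r + 1) + q * l by ring, hf1 q r h0 h1.le,
      hf1 q (r + 1) (by omega) (by omega), show (r + 1).toNat = r.toNat + 1 by omega]
    exact hadj _ _ _ (P.adj_getVert_succ (by omega))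
  have hdist : ∀ (n : ℤ) (m : ℕ), T.dist (f n) (f (n + m)) ≤ m := by
    intro n m
    induction m with
    | zero => simp
    | succ m ih =>
      have h1 := hT.connected.dist_triangle (u := f n) (v := f (n + m)) (w := f (n + m + 1))
      have h2 := SimpleGraph.dist_eq_one_iff_adj.2 (hfadj (n + m))
      push_cast
      rw [← add_assoc]
      omega
  refine ⟨f, l, ⟨hfadj, fun n hn => ?_⟩, hl0, hshift⟩
  by_cases h1 : l = 1
  · subst h1
    exact hni v _ _ (hfadj n) ⟨hshift n, (hshift (n + 1)).trans hn.symm⟩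
  · have h2 := hw (f (n + 1 + 1))
    have h3 := hdist (n + 1 + 1) (P.length - 2)
    have h4 : n + 1 + 1 + ((P.length - 2 : ℕ) : ℤ) = n + l := by omega
    rw [h4, ← hshift n, hn] at h3
    omega

end Axis

section Raag

variable {V : Type} {Γ : SimpleGraph V}

lemma RAAG.commute_gen {u v : V} (h : Γ.Adj u v) : Commute (RAAG.gen Γ u) (RAAG.gen Γ v) := by
  have := PresentedGroup.one_of_mem (rels := raagRels Γ) ⟨u, v, h, rfl⟩
  simp only [map_mul, map_inv] at this
  exact mul_inv_eq_iff_eq_mul.1 (mul_inv_eq_one.1 this)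

lemma RAAG.exists_hom {a b : V} (hab : a ≠ b) (hadj : ¬ Γ.Adj a b) {H : Type} [Group H] (x y : H) :
    ∃ ψ : RAAG Γ →* H, ψ (RAAG.gen Γ a) = x ∧ ψ (RAAG.gen Γ b) = y := by
  classical
  let f : V → H := fun w => if w = a then x else if w = b then y else 1
  have hf : ∀ r ∈ raagRels Γ, FreeGroup.lift f r = 1 := by
    rintro _ ⟨u, v, huv, rfl⟩
    have hne := huv.ne
    have hba : ¬ Γ.Adj b a := fun h => hadj h.symm
    simp only [map_mul, map_inv, FreeGroup.lift_apply_of, f]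
    split_ifs <;> simp_all
  exact ⟨PresentedGroup.toGroup hf, by simp [RAAG.gen, f], by simp [RAAG.gen, f, hab.symm]⟩

lemma RAAG.adj_of_commute {a b : V} (hab : a ≠ b)
    (h : RAAG.gen Γ a * RAAG.gen Γ b = RAAG.gen Γ b * RAAG.gen Γ a) : Γ.Adj a b := by
  by_contra hadj
  obtain ⟨ψ, ha, hb⟩ := RAAG.exists_hom hab hadj (finRotate 4) (Equiv.swap 0 1)
  have := congrArg ψ h
  rw [map_mul, map_mul, ha, hb] at this
  revert this
  decide

/-- The commutator `[a, b]` and its conjugate `[a, a * b * a⁻¹]` commute only if `a` and `b` do. -/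
lemma RAAG.adj_of_commute_commutator {a b : V} (hab : a ≠ b)
    (h : Commute
      (RAAG.gen Γ a * RAAG.gen Γ b * (RAAG.gen Γ a)⁻¹ * (RAAG.gen Γ b)⁻¹)
      (RAAG.gen Γ a * (RAAG.gen Γ a * RAAG.gen Γ b * (RAAG.gen Γ a)⁻¹) * (RAAG.gen Γ a)⁻¹ *
        (RAAG.gen Γ a * RAAG.gen Γ b * (RAAG.gen Γ a)⁻¹)⁻¹)) : Γ.Adj a b := by
  by_contra hadj
  obtain ⟨ψ, ha, hb⟩ := RAAG.exists_hom hab hadj (finRotate 4) (Equiv.swap 0 1)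
  have := congrArg ψ h.eq
  simp only [map_mul, map_inv, ha, hb] at this
  revert this
  decide

/-- The neighbourhood of a vertex acting without fixed vertices is a clique. -/
lemma RAAG.isClique_neighborSet {W : Type} {T : SimpleGraph W} (hT : T.IsTree)
    {φ : RAAG Γ →* Equiv.Perm W} (hadj : PreservesAdj T φ) (hni : NoInversions T φ)
    (hab : AbelianEdgeStabilizers T φ) {v : V} (hv : ¬ Elliptic φ (RAAG.gen Γ v)) :
    Γ.IsClique (Γ.neighborSet v) := by
  intro a ha b hb hne
  obtain ⟨f, l, hf, hl, hfv⟩ := exists_axis hT hadj hni hv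
  have hva := RAAG.commute_gen ha
  have hvb := RAAG.commute_gen hb
  have hsa := hf.exists_shift_of_commute hT hadj hl hfv hva
  have hsb := hf.exists_shift_of_commute hT hadj hl hfv hvb
  have hsc := hf.exists_shift_of_commute hT hadj hl hfv
    ((hva.mul_right hvb).mul_right hva.inv_right)
  exact RAAG.adj_of_commute_commutator hne (hab _ _ (hf.adj 0) _ _
    (commutator_apply_of_shift hsa hsb _) (commutator_apply_of_shift hsa hsb _)
    (commutator_apply_of_shift hsa hsc _) (commutator_apply_of_shift hsa hsc _))

lemma separatingClique_neighborSet (hncomp : ¬ ∀ u v : V, u ≠ v → Γ.Adj u v) {v : V}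
    (hclique : Γ.IsClique (Γ.neighborSet v)) : SeparatingClique Γ (Γ.neighborSet v) := by
  refine ⟨hclique, ?_⟩
  obtain ⟨z, hzv, hz⟩ : ∃ z, z ≠ v ∧ ¬ Γ.Adj v z := by
    by_contra! hall
    refine hncomp fun a b hne => ?_
    by_cases ha : a = v
    · exact ha ▸ hall b (ha ▸ hne.symm)
    by_cases hb : b = v
    · exact hb ▸ (hall a ha).symm
    exact hclique (hall a ha) (hall b hb) hne
  refine ⟨⟨v, by simp⟩, ⟨z, hz⟩, ?_⟩
  rintro ⟨w⟩
  cases w with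
  | nil => exact hzv rfl
  | @cons _ b _ hadj w => exact b.2 hadj

/-- If the common fixed set of some generators misses that of an elliptic generator `u`, then the
generators fixing a suitable edge form a separating clique. -/
lemma exists_separatingClique_of_disjoint_fixed {W : Type} {T : SimpleGraph W} (hT : T.IsTree)
    {φ : RAAG Γ →* Equiv.Perm W} (hadj : PreservesAdj T φ) (hab : AbelianEdgeStabilizers T φ)
    (hell : ∀ v, Elliptic φ (RAAG.gen Γ v)) {S : Set V} {u : V} {p : W}
    (hp : ∀ s ∈ S, φ (RAAG.gen Γ s) p = p)
    (hu : ∀ q, (∀ s ∈ S, φ (RAAG.gen Γ s) q = q) → φ (RAAG.gen Γ u) q ≠ q) :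
    ∃ K : Set V, SeparatingClique Γ K := by
  obtain ⟨q, hq⟩ := hell u
  obtain ⟨x, y, hxy, hx, hy, hsep⟩ := SameSide.exists_boundary hT
    {z | ∀ s ∈ S, φ (RAAG.gen Γ s) z = z} hp fun h => hu q h hq
  have hux := hu x hx
  obtain ⟨s, hsS, hsy⟩ : ∃ s ∈ S, φ (RAAG.gen Γ s) y ≠ y := by
    simpa using hy
  let K : Set V := {w | φ (RAAG.gen Γ w) x = x ∧ φ (RAAG.gen Γ w) y = y}
  have hside : ∀ w ∉ K, ∀ a b, φ (RAAG.gen Γ w) a = a → φ (RAAG.gen Γ w) b = b →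
      SameSide T s(x, y) a b := by
    intro w hw a b ha hb
    by_contra h
    exact hw (SameSide.fixed_of_not hT hadj ha hb h)
  refine ⟨K, fun a ha b hb hne =>
    RAAG.adj_of_commute hne (hab x y hxy _ _ ha.1 ha.2 hb.1 hb.2),
    ⟨s, fun h => hsy h.2⟩, ⟨u, fun h => hux h.1⟩, ?_⟩
  rintro ⟨w⟩
  have key : ∀ {c d : ↥(Kᶜ)} (_ : (Γ.induce Kᶜ).Walk c d) (a b : W),
      φ (RAAG.gen Γ c) a = a → φ (RAAG.gen Γ d) b = b → SameSide T s(x, y) a b := by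
    intro c d w
    induction w with
    | @nil c => exact hside c c.2
    | @cons c c' d h w ih =>
      intro a b ha hb
      obtain ⟨z, hz, hz'⟩ := exists_common_fixed_of_commute hT hadj
        (RAAG.commute_gen (Γ := Γ) h) (hell c) (hell c')
      exact (hside c c.2 a z ha hz).trans (ih z b hz' hb)
  exact hsep (key w p q (hp s hsS) hq)

lemma RAAG.hasGlobalFixedVertex_of_gen {W : Type} {φ : RAAG Γ →* Equiv.Perm W} {p : W}
    (hp : ∀ v, φ (RAAG.gen Γ v) p = p) : HasGlobalFixedVertex φ := by
  refine ⟨p, fun g => ?_⟩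
  have hg : g ∈ Subgroup.closure (Set.range (PresentedGroup.of (rels := raagRels Γ))) := by
    rw [PresentedGroup.closure_range_of]; trivial
  induction hg using Subgroup.closure_induction with
  | mem g hg => obtain ⟨v, rfl⟩ := hg; exact hp v
  | one => simp
  | mul g h _ _ hg hh => rw [map_mul, Equiv.Perm.mul_apply, hh, hg]
  | inv g _ hg => rw [map_inv, Equiv.Perm.inv_eq_iff_eq, hg]

end Raag

/-- If `Γ` is a finite connected simplicial graph which is not complete, and `A(Γ)`
acts without inversions on a simplicial tree with no global fixed vertex and all
edge stabilizers abelian, then `Γ` contains a separating clique. -/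
theorem separating_clique_of_abelian_splitting {V : Type} [Finite V]
    (Γ : SimpleGraph V) (hconn : Γ.Connected)
    (hncomp : ¬ ∀ u v : V, u ≠ v → Γ.Adj u v)
    {W : Type} (T : SimpleGraph W) (hT : T.IsTree) (φ : RAAG Γ →* Equiv.Perm W)
    (hadj : PreservesAdj T φ) (hni : NoInversions T φ)
    (hab : AbelianEdgeStabilizers T φ) (hnofix : ¬ HasGlobalFixedVertex φ) :
    ∃ K : Set V, SeparatingClique Γ K := by

  classical
  by_cases hell : ∀ v, Elliptic φ (RAAG.gen Γ v)
  · by_contra hno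
    cases nonempty_fintype V
    have key : ∀ S : Finset V, ∃ p, ∀ s ∈ S, φ (RAAG.gen Γ s) p = p := by
      intro S
      induction S using Finset.induction_on with
      | empty => exact ⟨hT.connected.nonempty.some, by simp⟩
      | insert u S _ ih =>
        obtain ⟨p, hp⟩ := ih
        by_contra! hu
        refine hno (exists_separatingClique_of_disjoint_fixed hT hadj hab hell (S := S) (u := u)
          hp fun q hq hq' => ?_)
        obtain ⟨s, hs, hsq⟩ := hu q
        rcases Finset.mem_insert.1 hs with rfl | hs
        · exact hsq hq'
        · exact hsq (hq s hs)
    obtain ⟨p, hp⟩ := key Finset.univ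
    exact hnofix (RAAG.hasGlobalFixedVertex_of_gen fun v => hp v (Finset.mem_univ v))
  · obtain ⟨v, hv⟩ := not_forall.1 hell
    exact ⟨Γ.neighborSet v, separatingClique_neighborSet hncomp
      (RAAG.isClique_neighborSet hT hadj hni hab hv)⟩
end

section
/- Let A(Γ) act without inversions on a simplicial tree T with all edge stabilizers abelian, and suppose a vertex v ∈ V(Γ) acts hyperbolically on T (fixes no vertex of T). Then star(v) is a clique in Γ, i.e., any two vertices of link(v) are adjacent in Γ. -/
namespace SimpleGraph

variable {W : Type} {T : SimpleGraph W}

theorem Connected.exists_adj_dist_add_one (hT : T.Connected) {p y : W} (h : p ≠ y) :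
    ∃ q, T.Adj p q ∧ T.dist q y + 1 = T.dist p y := by
  obtain ⟨w, hw⟩ := hT.exists_walk_length_eq_dist p y
  cases w with
  | nil => exact absurd rfl h
  | @cons _ q _ hpq w =>
    refine ⟨q, hpq, ?_⟩
    have h₁ := dist_le w
    have h₂ := hT.dist_triangle (u := p) (v := q) (w := y)
    rw [dist_eq_one_iff_adj.mpr hpq] at h₂
    rw [Walk.length_cons] at hw
    omega

theorem IsTree.eq_of_adj_of_dist_add_one (hT : T.IsTree) {p q q' y : W}
    (hq : T.Adj p q) (hq' : T.Adj p q')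
    (h : T.dist q y + 1 = T.dist p y) (h' : T.dist q' y + 1 = T.dist p y) : q = q' := by
  obtain ⟨w, hw⟩ := hT.connected.exists_walk_length_eq_dist q y
  obtain ⟨w', hw'⟩ := hT.connected.exists_walk_length_eq_dist q' y
  have key := (hT.existsUnique_path p y).unique
    ((Walk.cons hq w).isPath_of_length_eq_dist (by rw [Walk.length_cons]; omega))
    ((Walk.cons hq' w').isPath_of_length_eq_dist (by rw [Walk.length_cons]; omega))
  simpa using congrArg Walk.snd key

/-- An edge `pq` of a tree whose endpoints lie on different sides of an edge `xy` is that edge. -/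
theorem IsTree.eq_of_adj_of_dist_lt (hT : T.IsTree) {x y p q : W}
    (hxy : T.Adj x y) (hpq : T.Adj p q)
    (hp : T.dist p x < T.dist p y) (hq : T.dist q y < T.dist q x) : p = x := by
  by_contra hne
  have h₁ := hT.dist_eq_dist_add_one_of_adj p hxy
  have h₂ := hT.dist_eq_dist_add_one_of_adj q hxy
  have h₃ := hT.dist_eq_dist_add_one_of_adj x hpq
  have h₄ := hT.dist_eq_dist_add_one_of_adj y hpq
  simp only [dist_comm (u := x), dist_comm (u := y)] at h₃ h₄
  obtain ⟨r, hpr, hr⟩ := hT.connected.exists_adj_dist_add_one hne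
  have h₅ := hT.dist_eq_dist_add_one_of_adj r hxy
  have h₆ := hT.dist_eq_dist_add_one_of_adj y hpr
  simp only [dist_comm (u := y)] at h₆
  have := hT.eq_of_adj_of_dist_add_one hpq hpr (y := y) (by omega) (by omega)
  subst this
  omega

end SimpleGraph

section TreeAction

variable {G W : Type} [Group G] {T : SimpleGraph W} {φ : G →* Equiv.Perm W}

theorem PreservesAdj.dist_eq (hadj : PreservesAdj T φ) (hT : T.Connected) (g : G) (x y : W) :
    T.dist (φ g x) (φ g y) = T.dist x y := by
  have hle (g : G) (x y : W) : T.dist (φ g x) (φ g y) ≤ T.dist x y := by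
    obtain ⟨w, hw⟩ := hT.exists_walk_length_eq_dist x y
    have := SimpleGraph.dist_le (w.map (⟨φ g, fun h => hadj g _ _ h⟩ : T →g T))
    rw [SimpleGraph.Walk.length_map, hw] at this
    exact this
  refine le_antisymm (hle g x y) ?_
  simpa using hle g⁻¹ (φ g x) (φ g y)

/-- For `t` without fixed vertices, moving each vertex `x` one step towards `t x` is a map that
commutes with the centralizer of `t` and under which any two vertices eventually merge. -/
theorem exists_step_of_not_elliptic (hT : T.IsTree) (hadj : PreservesAdj T φ) {t : G}
    (ht : ¬ Elliptic φ t) :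
    ∃ N : W → W, (∀ x, T.Adj x (N x)) ∧ (∀ g, Commute g t → Function.Commute N (φ g)) ∧
      ∀ x y, ∃ i j, N^[i] x = N^[j] y := by
  have hne (x : W) : x ≠ φ t x := fun h => ht ⟨x, h.symm⟩
  choose N hN hd using fun x => hT.connected.exists_adj_dist_add_one (hne x)
  refine ⟨N, hN, fun g hg x => ?_, fun x y => ?_⟩
  · have hgt : φ t (φ g x) = φ g (φ t x) := by
      rw [← Equiv.Perm.mul_apply, ← Equiv.Perm.mul_apply, ← map_mul, ← map_mul, hg.eq]
    refine hT.eq_of_adj_of_dist_add_one (hN _) (hadj g _ _ (hN x)) (hd _) ?_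
    rw [hgt, hadj.dist_eq hT.connected, hadj.dist_eq hT.connected, hd]
  · obtain ⟨w⟩ := hT.connected x y
    induction w with
    | nil => exact ⟨0, 0, rfl⟩
    | @cons x y z hxy _ ih =>
      obtain ⟨k, l, hkl⟩ := ih
      suffices ∃ i j, N^[i] x = N^[j] y by
        obtain ⟨i, j, hij⟩ := this
        refine ⟨k + i, j + l, ?_⟩
        rw [Function.iterate_add_apply, hij, ← Function.iterate_add_apply, add_comm k j,
          Function.iterate_add_apply, hkl, ← Function.iterate_add_apply]
      by_cases hx : N x = y
      · exact ⟨1, 0, hx⟩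
      by_cases hy : N y = x
      · exact ⟨0, 1, hy.symm⟩
      exfalso
      have h₁ := hT.dist_eq_dist_add_one_of_adj (φ t x) hxy
      have h₂ := hT.dist_eq_dist_add_one_of_adj (φ t y) hxy
      simp only [SimpleGraph.dist_comm (u := φ t x), SimpleGraph.dist_comm (u := φ t y)] at h₁ h₂
      refine hne x (hT.eq_of_adj_of_dist_lt hxy (hadj t _ _ hxy) ?_ ?_).symm
      · rw [SimpleGraph.dist_comm, SimpleGraph.dist_comm (v := y)]
        rcases h₁ with h | h
        · exact absurd (hT.eq_of_adj_of_dist_add_one (hN x) hxy (hd x) h.symm) hx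
        · omega
      · rw [SimpleGraph.dist_comm, SimpleGraph.dist_comm (v := x)]
        rcases h₂ with h | h
        · omega
        · exact absurd (hT.eq_of_adj_of_dist_add_one (hN y) hxy.symm (hd y) h.symm) hy

/-- If two permutations commute with `N` and `N` merges all orbits, then each of them shifts
`N`-orbits eventually, so that they commute with one another far along any orbit. -/
theorem exists_apply_comm_of_commute {N : W → W} {a b : Equiv.Perm W}
    (ha : Function.Commute N a) (hb : Function.Commute N b)
    (hN : ∀ x y, ∃ i j, N^[i] x = N^[j] y) (x : W) :
    ∃ m, a (b (N^[m] x)) = b (a (N^[m] x)) := by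
  obtain ⟨i, j, hij⟩ := hN (a x) x
  obtain ⟨k, l, hkl⟩ := hN (b x) x
  refine ⟨i + k, ?_⟩
  have h₁ : a (b (N^[i + k] x)) = N^[l + j] x := by
    rw [Function.iterate_add_apply, ← (hb.iterate_left i).eq, ← (hb.iterate_left k).eq, hkl,
      ← (ha.iterate_left i).eq, ← (ha.iterate_left l).eq, ← Function.iterate_add_apply, add_comm,
      Function.iterate_add_apply, hij, Function.iterate_add_apply]
  have h₂ : b (a (N^[i + k] x)) = N^[l + j] x := by
    rw [add_comm i k, Function.iterate_add_apply, ← (ha.iterate_left k).eq,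
      ← (ha.iterate_left i).eq, hij, ← (hb.iterate_left k).eq, ← (hb.iterate_left j).eq,
      ← Function.iterate_add_apply, add_comm, Function.iterate_add_apply, hkl,
      ← Function.iterate_add_apply, add_comm]
  rw [h₁, h₂]

open scoped commutatorElement in
theorem exists_commutator_fixes_iterate {N : W → W} (hN : ∀ x y, ∃ i j, N^[i] x = N^[j] y)
    {g h : G} (hg : Function.Commute N (φ g)) (hh : Function.Commute N (φ h)) (x : W) :
    ∃ m, ∀ n, m ≤ n → φ ⁅g, h⁆ (N^[n] x) = N^[n] x := by
  have hinv {k : G} (hk : Function.Commute N (φ k)) : Function.Commute N (φ k⁻¹) := fun y => by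
    apply (φ k).injective
    rw [← hk.eq]
    simp
  have hc : Function.Commute N (φ ⁅g, h⁆) := by
    rw [commutatorElement_def]
    simp only [map_mul, Equiv.Perm.coe_mul]
    exact ((hg.comp_right hh).comp_right (hinv hg)).comp_right (hinv hh)
  obtain ⟨m, hm⟩ := exists_apply_comm_of_commute (hinv hg) (hinv hh) hN x
  refine ⟨m, fun n hmn => ?_⟩
  obtain ⟨k, rfl⟩ := Nat.exists_eq_add_of_le' hmn
  have hfix : φ ⁅g, h⁆ (N^[m] x) = N^[m] x := by
    simp only [commutatorElement_def, mul_assoc, map_mul, Equiv.Perm.mul_apply, hm]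
    simp
  rw [Function.iterate_add_apply, ← (hc.iterate_left k).eq, hfix]

open scoped commutatorElement in
/-- If `t` acts without fixed vertices on a tree with abelian edge stabilizers, then commutators of
elements centralizing `t` commute. -/
theorem commute_commutators_of_not_elliptic (hT : T.IsTree) (hadj : PreservesAdj T φ)
    (hab : AbelianEdgeStabilizers T φ) {t : G} (ht : ¬ Elliptic φ t) {a b c d : G}
    (ha : Commute a t) (hb : Commute b t) (hc : Commute c t) (hd : Commute d t) :
    Commute ⁅a, b⁆ ⁅c, d⁆ := by
  obtain ⟨N, hN, hcomm, hmerge⟩ := exists_step_of_not_elliptic hT hadj ht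
  obtain ⟨x⟩ := hT.connected.nonempty
  obtain ⟨m, hm⟩ := exists_commutator_fixes_iterate hmerge (hcomm a ha) (hcomm b hb) x
  obtain ⟨n, hn⟩ := exists_commutator_fixes_iterate hmerge (hcomm c hc) (hcomm d hd) x
  have hedge : T.Adj (N^[m + n] x) (N^[m + n + 1] x) := by
    rw [Function.iterate_succ_apply']
    exact hN _
  exact hab _ _ hedge _ _ (hm _ (by omega)) (hm _ (by omega)) (hn _ (by omega)) (hn _ (by omega))

end TreeAction

namespace RAAG

variable {V : Type} {Γ : SimpleGraph V}

theorem commute_gen_s6 {u v : V} (h : Γ.Adj u v) : Commute (gen Γ u) (gen Γ v) := by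
  have := PresentedGroup.one_of_mem (rels := raagRels Γ) ⟨u, v, h, rfl⟩
  simp only [map_mul, map_inv] at this
  exact mul_inv_eq_iff_eq_mul.mp (mul_inv_eq_one.mp this)

/-- Two nonadjacent vertices can be sent to arbitrary elements of a group. -/
theorem exists_hom_of_not_adj {H : Type} [Group H] {u w : V} (hne : u ≠ w) (h : ¬ Γ.Adj u w)
    (a b : H) : ∃ f : RAAG Γ →* H, f (gen Γ u) = a ∧ f (gen Γ w) = b := by
  classical
  let F : V → H := fun x => if x = u then a else if x = w then b else 1
  have hF : ∀ r ∈ raagRels Γ, FreeGroup.lift F r = 1 := by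
    rintro r ⟨x, y, hxy, rfl⟩
    have hxy' := hxy.ne
    have hwu : ¬ Γ.Adj w u := fun h' => h h'.symm
    simp only [map_mul, map_inv, FreeGroup.lift_apply_of, F]
    split_ifs <;> simp_all
  refine ⟨PresentedGroup.toGroup hF, ?_, ?_⟩
  · simp [gen, F]
  · simp [gen, F, hne.symm]

open scoped commutatorElement in
theorem adj_of_commute_commutators {u w : V} (hne : u ≠ w)
    (h : Commute ⁅gen Γ u, gen Γ w⁆ ⁅(gen Γ u)⁻¹, gen Γ w⁆) : Γ.Adj u w := by
  by_contra hnadj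
  obtain ⟨f, hu, hw⟩ := exists_hom_of_not_adj hne hnadj (finRotate 4) (Equiv.swap 0 1)
  have := h.map f
  simp only [map_commutatorElement, map_inv, hu, hw] at this
  revert this
  simp only [commute_iff_eq, commutatorElement_def]
  decide

end RAAG

/-- If `A(Γ)` acts without inversions on a simplicial tree with abelian edge
stabilizers and a vertex `v` of `Γ` acts hyperbolically, then `star(v)` is a
clique in `Γ`. -/
theorem star_is_clique_of_hyperbolic {V W : Type} [Finite V]
    (Γ : SimpleGraph V) (T : SimpleGraph W) (hT : T.IsTree)
    (φ : RAAG Γ →* Equiv.Perm W)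
    (hadj : PreservesAdj T φ) (hni : NoInversions T φ)
    (hab : AbelianEdgeStabilizers T φ)
    (v : V) (hv : ¬ Elliptic φ (RAAG.gen Γ v)) :
    Γ.IsClique (insert v (Γ.neighborSet v)) := by
  refine Γ.isClique_insert.mpr ⟨fun u hu w hw hne => ?_, fun w hw _ => hw⟩
  have hu' := (RAAG.commute_gen_s6 hu).symm
  have hw' := (RAAG.commute_gen_s6 hw).symm
  exact RAAG.adj_of_commute_commutators hne
    (commute_commutators_of_not_elliptic hT hadj hab hv hu' hw' hu'.inv_left hw')
end

section
/- Let Γ be a finite simplicial graph and let Γ′ be a connected induced subgraph of Γ that contains no separating clique (of Γ′). Suppose A(Γ) acts without inversions on a simplicial tree T with all edge stabilizers abelian and with every vertex of Γ acting elliptically. Then the subgroup A(Γ′) generated by the vertices of Γ′ acts elliptically on T, i.e., fixes a vertex of T. -/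
/-- In a tree, a point of a geodesic is determined by its distances to the endpoints. -/
theorem SimpleGraph.IsTree.eq_of_dist_add_dist_eq {W : Type*} {T : SimpleGraph W}
    (hT : T.IsTree) {y z m n : W} (hm : T.dist y m + T.dist m z = T.dist y z)
    (hn : T.dist y n + T.dist n z = T.dist y z) (h : T.dist y m = T.dist y n) : m = n := by
  obtain ⟨p, hp⟩ := hT.connected.exists_walk_length_eq_dist y m
  obtain ⟨q, hq⟩ := hT.connected.exists_walk_length_eq_dist m z
  obtain ⟨r, hr⟩ := hT.connected.exists_walk_length_eq_dist y n
  obtain ⟨s, hs⟩ := hT.connected.exists_walk_length_eq_dist n z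
  have h₁ : (p.append q).IsPath :=
    SimpleGraph.Walk.isPath_of_length_eq_dist _ (by rw [Walk.length_append, hp, hq, hm])
  have h₂ : (r.append s).IsPath :=
    SimpleGraph.Walk.isPath_of_length_eq_dist _ (by rw [Walk.length_append, hr, hs, hn])
  have heq : p.append q = r.append s := (hT.existsUnique_path y z).unique h₁ h₂
  have hget := congrArg (fun w => w.getVert (T.dist y m)) heq
  simpa [Walk.getVert_append, hp, hr, h] using hget

/-- In a tree, a vertex has at most one neighbour closer to a given vertex. -/
theorem SimpleGraph.IsTree.eq_of_adj_of_dist {W : Type*} {T : SimpleGraph W}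
    (hT : T.IsTree) {x y b c : W} (hb : T.Adj x b) (hc : T.Adj x c)
    (hby : T.dist x y = T.dist b y + 1) (hcy : T.dist x y = T.dist c y + 1) : b = c := by
  have hb' := SimpleGraph.dist_eq_one_iff_adj.2 hb
  have hc' := SimpleGraph.dist_eq_one_iff_adj.2 hc
  exact hT.eq_of_dist_add_dist_eq (y := x) (z := y) (by omega) (by omega) (by omega)

theorem SimpleGraph.Connected.exists_adj_dist_eq {W : Type*} {T : SimpleGraph W}
    (hT : T.Connected) {x y : W} (hne : x ≠ y) :
    ∃ b, T.Adj x b ∧ T.dist x y = T.dist b y + 1 := by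
  obtain ⟨p, hp⟩ := hT.exists_walk_length_eq_dist x y
  cases p with
  | nil => exact absurd rfl hne
  | @cons _ b _ hadj q =>
    refine ⟨b, hadj, ?_⟩
    have h₁ := SimpleGraph.dist_le q
    have h₂ := hT.dist_triangle (u := x) (v := b) (w := y)
    have h₃ := SimpleGraph.dist_eq_one_iff_adj.2 hadj
    rw [Walk.length_cons] at hp
    omega

/-- If the vertices `y` and `z` lie on the two sides of the edge `ab` of a tree, then
the geodesic from `y` to `z` crosses this edge. -/
theorem SimpleGraph.IsTree.dist_eq_of_opposite_sides {W : Type*} {T : SimpleGraph W}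
    (hT : T.IsTree) {y z : W} {a b : W} (hab : T.Adj a b) (hy : T.dist b y = T.dist a y + 1)
    (hz : T.dist a z = T.dist b z + 1) : T.dist y z = T.dist a y + 1 + T.dist b z := by
  induction hn : T.dist b z generalizing a b with
  | zero =>
    obtain rfl := hT.connected.dist_eq_zero_iff.1 hn
    rw [SimpleGraph.dist_comm]
    omega
  | succ n ih =>
    have hne : b ≠ z := by
      rintro rfl
      simp at hn
    obtain ⟨c, hbc, hc⟩ := hT.connected.exists_adj_dist_eq hne
    have hcy : T.dist c y = T.dist b y + 1 := by
      rcases hT.dist_eq_dist_add_one_of_adj y hbc with h | h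
      · rw [SimpleGraph.dist_comm, SimpleGraph.dist_comm (u := y)] at h
        obtain rfl := hT.eq_of_adj_of_dist hab.symm hbc hy h
        omega
      · rw [SimpleGraph.dist_comm, h, SimpleGraph.dist_comm]
    rw [ih hbc hcy hc (by omega)]
    omega

section TreeAction

variable {G W : Type} [Group G] {T : SimpleGraph W} {φ : G →* Equiv.Perm W}

theorem PreservesAdj.dist_apply (hadj : PreservesAdj T φ) (hT : T.IsTree) (g : G) (x y : W) :
    T.dist (φ g x) (φ g y) = T.dist x y := by
  have key : ∀ (g : G) (x y : W), T.dist (φ g x) (φ g y) ≤ T.dist x y := by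
    intro g x y
    obtain ⟨p, hp⟩ := hT.connected.exists_walk_length_eq_dist x y
    let f : T →g T := ⟨φ g, hadj g _ _⟩
    rw [← hp, ← SimpleGraph.Walk.length_map f p]
    exact SimpleGraph.dist_le _
  refine le_antisymm (key g x y) ?_
  simpa [← Equiv.Perm.mul_apply, ← map_mul] using key g⁻¹ (φ g x) (φ g y)

/-- An element with fixed vertices on both sides of an edge fixes this edge. -/
theorem PreservesAdj.fixes_edge_of_opposite_sides (hadj : PreservesAdj T φ) (hT : T.IsTree)
    {g : G} {a b y z : W} (hab : T.Adj a b) (hgy : φ g y = y) (hgz : φ g z = z)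
    (hy : T.dist b y = T.dist a y + 1) (hz : T.dist a z = T.dist b z + 1) :
    φ g a = a ∧ φ g b = b := by
  have hyz := hT.dist_eq_of_opposite_sides hab hy hz
  have e₁ : ∀ m, T.dist y (φ g m) = T.dist y m := fun m => by
    conv_lhs => rw [← hgy]
    exact hadj.dist_apply hT g y m
  have e₂ : ∀ m, T.dist (φ g m) z = T.dist m z := fun m => by
    conv_lhs => rw [← hgz]
    exact hadj.dist_apply hT g m z
  have ha : T.dist y a = T.dist a y := SimpleGraph.dist_comm
  have hb : T.dist y b = T.dist b y := SimpleGraph.dist_comm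
  constructor <;>
    exact hT.eq_of_dist_add_dist_eq (y := y) (z := z) (by rw [e₁, e₂]; omega) (by omega) (e₁ _)

/-- The fixed vertices of an element which does not fix the edge `xb` all lie on the
same side of this edge. -/
theorem PreservesAdj.fixed_same_side (hadj : PreservesAdj T φ) (hT : T.IsTree)
    {g : G} {x b y z : W} (hxb : T.Adj x b) (hg : ¬(φ g x = x ∧ φ g b = b))
    (hgy : φ g y = y) (hgz : φ g z = z) (hy : T.dist x y = T.dist b y + 1) :
    T.dist x z = T.dist b z + 1 := by
  rcases hT.dist_eq_dist_add_one_of_adj z hxb with h | h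
  · rwa [SimpleGraph.dist_comm, SimpleGraph.dist_comm (u := z)] at h
  · rw [SimpleGraph.dist_comm, SimpleGraph.dist_comm (u := z)] at h
    exact absurd (hadj.fixes_edge_of_opposite_sides hT hxb hgz hgy h hy) hg

/-- Two commuting elliptic automorphisms of a tree have a common fixed vertex. -/
theorem PreservesAdj.exists_common_fixed (hadj : PreservesAdj T φ) (hT : T.IsTree)
    {g h : G} (hgh : Commute g h) (hg : Elliptic φ g) (hh : Elliptic φ h) :
    ∃ w, φ g w = w ∧ φ h w = w := by
  obtain ⟨x, hx⟩ := hg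
  obtain ⟨y, hy⟩ := hh
  induction hn : T.dist x y generalizing x with
  | zero =>
    obtain rfl := hT.connected.dist_eq_zero_iff.1 hn
    exact ⟨x, hx, hy⟩
  | succ n ih =>
    by_cases hhx : φ h x = x
    · exact ⟨x, hx, hhx⟩
    have hne : x ≠ y := by
      rintro rfl
      exact hhx hy
    obtain ⟨b, hxb, hb⟩ := hT.connected.exists_adj_dist_eq hne
    have hy' : φ h (φ g⁻¹ y) = φ g⁻¹ y := by
      rw [← Equiv.Perm.mul_apply, ← map_mul, ← hgh.inv_left.eq, map_mul, Equiv.Perm.mul_apply, hy]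
    have hside := hadj.fixed_same_side hT hxb (fun hc => hhx hc.1) hy hy' hb
    have hgy : φ g (φ g⁻¹ y) = y := by simp
    rw [← hadj.dist_apply hT g x, ← hadj.dist_apply hT g b, hgy, hx] at hside
    have hgb : T.Adj x (φ g b) := by
      simpa [hx] using hadj g x b hxb
    exact ih b (hT.eq_of_adj_of_dist hgb hxb hside hb) (by omega)

/-- Suppose that elliptic automorphisms of a tree are indexed by the vertices of a graph `Λ`,
adjacent vertices giving commuting automorphisms, and that the vertices whose automorphism
fixes a given edge never separate `Λ`. Then finitely many of these automorphisms always have a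
common fixed vertex. -/
theorem PreservesAdj.exists_fixed_of_not_separating (hadj : PreservesAdj T φ) (hT : T.IsTree)
    {ι : Type} (Λ : SimpleGraph ι) (γ : ι → G) (hell : ∀ i, Elliptic φ (γ i))
    (hcomm : ∀ i j, Λ.Adj i j → Commute (γ i) (γ j))
    (hconn : ∀ a b, T.Adj a b →
      (Λ.induce {i | φ (γ i) a = a ∧ φ (γ i) b = b}ᶜ).Preconnected)
    (F : Finset ι) : ∃ w, ∀ i ∈ F, φ (γ i) w = w := by
  classical
  have step : ∀ x i, ∃ w, φ (γ i) w = w ∧ ∀ j, φ (γ j) x = x → φ (γ j) w = w := by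
    intro x i
    obtain ⟨y, hy⟩ := hell i
    induction hn : T.dist x y generalizing x with
    | zero =>
      obtain rfl := hT.connected.dist_eq_zero_iff.1 hn
      exact ⟨x, hy, fun _ => id⟩
    | succ n ih =>
      by_cases hix : φ (γ i) x = x
      · exact ⟨x, hix, fun _ => id⟩
      have hne : x ≠ y := by
        rintro rfl
        exact hix hy
      obtain ⟨b, hxb, hb⟩ := hT.connected.exists_adj_dist_eq hne
      let K : Set ι := {i | φ (γ i) x = x ∧ φ (γ i) b = b}
      have hside : ∀ j k : ↥Kᶜ, (Λ.induce Kᶜ).Reachable j k →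
          (∀ z, φ (γ j) z = z → T.dist x z = T.dist b z + 1) →
          ∀ z, φ (γ k) z = z → T.dist x z = T.dist b z + 1 := by
        rintro j k ⟨p⟩ hj
        induction p with
        | nil => exact hj
        | @cons j l k hjl _ ih =>
          refine ih fun z hz => ?_
          obtain ⟨w, hjw, hlw⟩ :=
            hadj.exists_common_fixed hT (hcomm j l hjl) (hell j) (hell l)
          exact hadj.fixed_same_side hT hxb l.2 hlw hz (hj w hjw)
      have hfix : ∀ j, φ (γ j) x = x → φ (γ j) b = b := by
        intro j hj
        by_contra hjb
        have h := hside ⟨i, fun hc => hix hc.1⟩ ⟨j, fun hc => hjb hc.2⟩ (hconn x b hxb _ _)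
          (fun z hz => hadj.fixed_same_side hT hxb (fun hc => hix hc.1) hy hz hb) x hj
        simp at h
      obtain ⟨w, hw, hwj⟩ := ih b (by omega)
      exact ⟨w, hw, fun j hj => hwj j (hfix j hj)⟩
  induction F using Finset.induction_on with
  | empty =>
    obtain ⟨w⟩ := hT.connected.nonempty
    exact ⟨w, by simp⟩
  | insert i F _ ih =>
    obtain ⟨x, hx⟩ := ih
    obtain ⟨w, hw, hwj⟩ := step x i
    refine ⟨w, fun j hj => ?_⟩
    rcases Finset.mem_insert.1 hj with rfl | hj
    · exact hw
    · exact hwj j (hx j hj)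

end TreeAction

theorem RAAG.commute_gen_of_adj {V : Type} {Γ : SimpleGraph V} {u v : V} (h : Γ.Adj u v) :
    Commute (RAAG.gen Γ u) (RAAG.gen Γ v) := by
  have hrel : (PresentedGroup.mk (raagRels Γ)) (FreeGroup.of u * FreeGroup.of v *
      (FreeGroup.of u)⁻¹ * (FreeGroup.of v)⁻¹) = 1 :=
    PresentedGroup.one_of_mem ⟨u, v, h, rfl⟩
  simp only [map_mul, map_inv] at hrel
  rw [mul_inv_eq_one, mul_inv_eq_iff_eq_mul] at hrel
  exact hrel

/-- Distinct commuting generators of a right-angled Artin group come from adjacent vertices. -/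
theorem RAAG.adj_of_commute_gen {V : Type} {Γ : SimpleGraph V} {u v : V} (huv : u ≠ v)
    (h : Commute (RAAG.gen Γ u) (RAAG.gen Γ v)) : Γ.Adj u v := by
  classical
  by_contra hn
  let f : V → Equiv.Perm (Fin 3) := fun x =>
    if x = u then Equiv.swap 0 1 else if x = v then Equiv.swap 1 2 else 1
  have hf : ∀ r ∈ raagRels Γ, FreeGroup.lift f r = 1 := by
    rintro r ⟨a, b, hab, rfl⟩
    have hcomm : f a * f b = f b * f a := by
      by_cases hau : a = u <;> by_cases hav : a = v <;> by_cases hbu : b = u <;>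
        by_cases hbv : b = v <;> simp_all [f, SimpleGraph.adj_comm]
    simp [hcomm]
  have := h.map (PresentedGroup.toGroup hf)
  simp only [RAAG.gen, PresentedGroup.toGroup.of, f, if_true, if_neg huv.symm] at this
  revert this
  unfold Commute SemiconjBy
  decide

/-- Let `Γ′` be a connected induced subgraph of `Γ` with no separating clique. If
`A(Γ)` acts without inversions on a simplicial tree with abelian edge stabilizers
and every vertex of `Γ` elliptic, then the subgroup `A(Γ′)` fixes a vertex. -/
theorem no_separating_clique_implies_elliptic {V W : Type} [Finite V]
    (Γ : SimpleGraph V) (S : Set V)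
    (hconn : (Γ.induce S).Connected)
    (hnosep : ¬ ∃ K : Set ↥S, SeparatingClique (Γ.induce S) K)
    (T : SimpleGraph W) (hT : T.IsTree) (φ : RAAG Γ →* Equiv.Perm W)
    (hadj : PreservesAdj T φ) (hni : NoInversions T φ)
    (hab : AbelianEdgeStabilizers T φ)
    (hvert : ∀ v : V, Elliptic φ (RAAG.gen Γ v)) :
    ∃ w : W, ∀ g ∈ Subgroup.closure (RAAG.gen Γ '' S), φ g w = w := by
  obtain ⟨w, hw⟩ := hadj.exists_fixed_of_not_separating hT (Γ.induce S)
    (fun s : ↥S => RAAG.gen Γ s) (fun s => hvert s) (fun _ _ h => RAAG.commute_gen_of_adj h)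
    (fun a b h x y => by
      by_contra hxy
      refine hnosep ⟨_, fun i hi j hj hij => ?_, x, y, hxy⟩
      exact RAAG.adj_of_commute_gen (Γ := Γ) (Subtype.coe_injective.ne hij)
        (hab a b h _ _ hi.1 hi.2 hj.1 hj.2))
    (Set.finite_univ (α := ↥S)).toFinset
  refine ⟨w, fun g hg => ?_⟩
  induction hg using Subgroup.closure_induction with
  | mem g hg =>
    obtain ⟨s, hs, rfl⟩ := hg
    exact hw ⟨s, hs⟩ (by simp)
  | one => simp
  | mul g h _ _ hg hh => rw [map_mul, Equiv.Perm.mul_apply, hh, hg]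
  | inv g _ hg => rw [map_inv, Equiv.Perm.inv_eq_iff_eq, hg]
end
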